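/- arXiv:1109.5055 — 2 statements merged into one kernel-verified Lean document; each statement's English description precedes it below -/
import Mathlib

section
/- Assume 𝓘 is not contained in the radical of Ann(M) and let J be a finitely generated R-submodule of G_1 of finite colength. Suppose x_{11},…,x_{1m}, x_{21},…,x_{2n}, …, x_{t1},…,x_{tp₀} is a maximal weak-(FC)-sequence with respect to (I_1,…,I_q; M) contained in I_1 ∪ ⋯ ∪ I_q, with x_{j1},…, belonging to I_j for each j = 1,…,t, and let 𝔍_j be the R-submodule of G_1 generated by x_{j1},…. Then for any k ≤ t one has (Σ_{j=1}^{k} 𝔍_j M_{p+|r|−1}) ∩ I^r M_p = Σ_{j=1}^{k} 𝔍_j I^{r−δ(j)} M_p, for all sufficiently large r_1,…,r_q and all p. -/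
/- Common framework: graded algebras over a Noetherian local ring, products of
linear submodules with graded pieces of a module, (FC)-sequences, saturations,
Hilbert polynomials of several variables, mixed multiplicities and
Buchsbaum-Rim multiplicities. -/

open scoped BigOperators

noncomputable section

namespace MixedMult

variable {R A M : Type*} [CommRing R] [CommRing A] [Algebra R A]
  [AddCommGroup M] [Module R M] [Module A M] [IsScalarTower R A M]

/-- The product `I·N` of an `R`-submodule `I` of the algebra `A` with an
`R`-submodule `N` of the `A`-module `M`. -/
def smulSM (I : Submodule R A) (N : Submodule R M) : Submodule R M :=
  Submodule.span R {z : M | ∃ a ∈ I, ∃ m ∈ N, a • m = z}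

/-- The multi-index power `I₁^{r₁} ⋯ I_s^{r_s}` of a family of `R`-submodules of `A`. -/
def Ipow {s : ℕ} (F : Fin s → Submodule R A) (r : Fin s → ℕ) : Submodule R A :=
  ∏ i, F i ^ r i

/-- The ideal `𝓘` of `A` generated by the product `I₁⋯I_q`. -/
def idealGen {s : ℕ} (I : Fin s → Submodule R A) : Ideal A :=
  Ideal.span ((∏ i, I i : Submodule R A) : Set A)

/-- The saturation `(U :_M 𝓘^∞) = {z ∈ M | 𝓘^k z ⊆ U for some k}`. -/
def sat (𝓘 : Ideal A) (U : Submodule A M) : Submodule A M :=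
  ⨆ k : ℕ, ⨅ a ∈ 𝓘 ^ k, U.comap (LinearMap.lsmul A M a)

/-- The `A`-submodule `(x₁,…,x_t)M` of `M` generated by a set of elements of `A`. -/
def spanM (s : Set A) : Submodule A M := Ideal.span s • (⊤ : Submodule A M)

/-- The length `ℓ(Q/P)` of the subquotient `Q/(P ∩ Q)` of two `R`-submodules of a module. -/
def colength (R : Type*) {M : Type*} [CommRing R] [AddCommGroup M] [Module R M]
    (P Q : Submodule R M) : ℕ∞ :=
  Order.height (⊤ : Submodule R (↥Q ⧸ P.comap Q.subtype))

/-- `dim Supp (M/N)`: the Krull dimension of the support of `M/N` inside `Proj A`, i.e. the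
set of homogeneous primes of `A` not containing `A₊` but containing the annihilator. -/
def dimProjSupp (𝒜 : ℕ → Submodule R A) [GradedAlgebra 𝒜] (N : Submodule A M) :
    WithBot ℕ∞ :=
  Order.krullDim {P : PrimeSpectrum A //
    Ideal.IsHomogeneous 𝒜 P.asIdeal ∧ ¬ ((𝒜 1 : Set A) ⊆ ↑P.asIdeal) ∧
    Module.annihilator A (M ⧸ N) ≤ P.asIdeal}

/-- The dimension of `Proj` of the graded ring `A`. -/
def dimProj (𝒜 : ℕ → Submodule R A) [GradedAlgebra 𝒜] : WithBot ℕ∞ :=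
  Order.krullDim {P : PrimeSpectrum A //
    Ideal.IsHomogeneous 𝒜 P.asIdeal ∧ ¬ ((𝒜 1 : Set A) ⊆ ↑P.asIdeal)}

/-- `b = a - 1`, where dimensions take values in `WithBot ℕ∞` and the empty
support has dimension `⊥` (i.e. `-∞`, playing the role of `-1`). -/
def DropsByOne (a b : WithBot ℕ∞) : Prop :=
  b = a + 1 ∨ (b = 0 ∧ a = ⊥)

/-- The height of an ideal: the infimum of the heights of the primes containing it. -/
def idealHeight {B : Type*} [CommRing B] (I : Ideal B) : ℕ∞ :=
  ⨅ P : {P : PrimeSpectrum B // I ≤ P.asIdeal}, Order.height (P : PrimeSpectrum B)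

variable (R) in
/-- `x` is a weak-(FC)-element at index `i` with respect to the family `F` of
`R`-submodules of `A₁` and the graded module `ℳ`, relative to a previous stage
given by the degree-one part `S` (span of the previously chosen elements) and
`K ⊆ M` (the submodule generated by the previously chosen elements), so that the
conditions are those of the images in `A/(x₁,…)` and `M/(x₁,…)M`.
`(FC₁)`: `x ∈ F i ∖ 𝔪·F i` and `F^r M_p ∩ x M_{|r|+p-1} = x F^{r-δ(i)} M_p` for all `p`
and all `r` with `r i` large; `(FC₂)`: `(0 : x) ⊆ (0 : 𝓘^∞)`. -/
def IsWeakFCElemAt [IsLocalRing R] {s : ℕ} (ℳ : ℕ → Submodule R M)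
    (F : Fin s → Submodule R A) (𝓘 : Ideal A) (i : Fin s) (x : A)
    (S : Submodule R A) (K : Submodule A M) : Prop :=
  x ∈ F i ∧ x ∉ ((IsLocalRing.maximalIdeal R) • F i ⊔ S) ∧
  (∃ ri : ℕ, 0 < ri ∧ ∀ (p : ℕ) (r : Fin s → ℕ), ri ≤ r i →
    (smulSM (Ipow F r) (ℳ p) ⊔ K.restrictScalars R) ⊓
      (smulSM (Submodule.span R {x}) (ℳ ((∑ l, r l) + p - 1)) ⊔ K.restrictScalars R) =
      smulSM (Submodule.span R {x} * Ipow F (Function.update r i (r i - 1))) (ℳ p) ⊔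
        K.restrictScalars R) ∧
  K.comap (LinearMap.lsmul A M x) ≤ sat 𝓘 K

variable (R) in
/-- `x` is an (FC)-element at index `i`: a weak-(FC)-element which moreover satisfies
`(FC₃)`: `dim Supp (M/(xM : 𝓘^∞)) = dim Supp (M/(0 : 𝓘^∞)) - 1` (relative to the
previous stage `(S, K)`). -/
def IsFCElemAt [IsLocalRing R] (𝒜 : ℕ → Submodule R A) [GradedAlgebra 𝒜] {s : ℕ}
    (ℳ : ℕ → Submodule R M) (F : Fin s → Submodule R A) (𝓘 : Ideal A) (i : Fin s)
    (x : A) (S : Submodule R A) (K : Submodule A M) : Prop :=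
  IsWeakFCElemAt R ℳ F 𝓘 i x S K ∧
    DropsByOne (dimProjSupp 𝒜 (sat 𝓘 (K ⊔ spanM {x}))) (dimProjSupp 𝒜 (sat 𝓘 K))

/-- The set of predecessors of `x j` in the sequence `x`. -/
def prevSet {t : ℕ} (x : Fin t → A) (j : Fin t) : Set A := x '' {l | l < j}

variable (R) in
/-- `x₁,…,x_t` is a weak-(FC)-sequence with respect to `(F; ℳ)`, where `x_j` is taken in
`F (c j)`: each `x_j` is a weak-(FC)-element modulo the previously chosen elements. -/
def IsWeakFCSeq [IsLocalRing R] {s t : ℕ} (ℳ : ℕ → Submodule R M)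
    (F : Fin s → Submodule R A) (𝓘 : Ideal A) (x : Fin t → A) (c : Fin t → Fin s) : Prop :=
  ∀ j, IsWeakFCElemAt R ℳ F 𝓘 (c j) (x j)
    (Submodule.span R (prevSet x j)) (spanM (prevSet x j))

variable (R) in
/-- `x₁,…,x_t` is an (FC)-sequence with respect to `(F; ℳ)`. -/
def IsFCSeq [IsLocalRing R] (𝒜 : ℕ → Submodule R A) [GradedAlgebra 𝒜] {s t : ℕ}
    (ℳ : ℕ → Submodule R M) (F : Fin s → Submodule R A) (𝓘 : Ideal A)
    (x : Fin t → A) (c : Fin t → Fin s) : Prop :=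
  ∀ j, IsFCElemAt R 𝒜 ℳ F 𝓘 (c j) (x j)
    (Submodule.span R (prevSet x j)) (spanM (prevSet x j))

/-- `x` is an `ε`-superficial element for the family `F` with respect to `ℳ`, relative to a
previous stage `K`: `x ∈ F ε` and the image of `x` is a filter-regular element on
`T = ⊕ F^r M_{p+s}/F^{r+1} M_p`, i.e. for all `r ≫ 0` and all `p`, any `z ∈ F^r M_{p+s}`
with `x·z ∈ F^{r+1+δ(ε)} M_p` lies in `F^{r+1} M_p`. -/
def IsSuperficialAt {s : ℕ} (ℳ : ℕ → Submodule R M) (F : Fin s → Submodule R A)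
    (ε : Fin s) (x : A) (K : Submodule A M) : Prop :=
  x ∈ F ε ∧ ∃ r₀ : ℕ, ∀ (r : Fin s → ℕ) (p : ℕ), (∀ i, r₀ ≤ r i) →
    (smulSM (Ipow F r) (ℳ (p + s)) ⊔ K.restrictScalars R) ⊓
      ((smulSM (Ipow F (fun l => r l + 1 + (if l = ε then 1 else 0))) (ℳ p) ⊔
          K.restrictScalars R).comap ((LinearMap.lsmul A M x).restrictScalars R)) ≤
      smulSM (Ipow F (fun l => r l + 1)) (ℳ p) ⊔ K.restrictScalars R

/-- `x₁,…,x_m` is an `(ε₁,…,ε_m)`-superficial sequence for the family `F` with respect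
to `ℳ`: each `x_j` is `ε_j`-superficial modulo the previously chosen elements. -/
def IsSuperficialSeq {s m : ℕ} (ℳ : ℕ → Submodule R M) (F : Fin s → Submodule R A)
    (x : Fin m → A) (ε : Fin m → Fin s) : Prop :=
  ∀ j, IsSuperficialAt ℳ F (ε j) (x j) (spanM (prevSet x j))

/-- The evaluation point `(n, p, r₁, …, r_q)` as rationals. -/
def vals {q : ℕ} (n p : ℕ) (r : Fin q → ℕ) : Fin (q + 2) → ℚ :=
  Fin.cons (n : ℚ) (Fin.cons (p : ℚ) fun i => (r i : ℚ))

/-- The Hilbert function `ℓ(I^r M_{n+p} / J^n I^r M_p)`. -/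
def mixedLen {q : ℕ} (J : Submodule R A) (I : Fin q → Submodule R A)
    (ℳ : ℕ → Submodule R M) (n p : ℕ) (r : Fin q → ℕ) : ℕ∞ :=
  colength R (smulSM (J ^ n * Ipow I r) (ℳ p)) (smulSM (Ipow I r) (ℳ (n + p)))

/-- `P` is a polynomial (in the `q+2` variables `n, p, r₁, …, r_q`) which agrees with
the Hilbert function `ℓ(I^r M_{n+p}/J^n I^r M_p)` for all sufficiently large `n, p, r`. -/
def IsMixedPoly {q : ℕ} (J : Submodule R A) (I : Fin q → Submodule R A)
    (ℳ : ℕ → Submodule R M) (P : MvPolynomial (Fin (q + 2)) ℚ) : Prop :=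
  ∃ N₀ : ℕ, ∀ (n p : ℕ) (r : Fin q → ℕ), N₀ ≤ n → N₀ ≤ p → (∀ i, N₀ ≤ r i) →
    ∃ L : ℕ, mixedLen J I ℳ n p r = (L : ℕ∞) ∧
      MvPolynomial.eval (vals n p r) P = (L : ℚ)

/-- The mixed multiplicity `e^j(J^{[k₀]}, I₁^{[k₁]}, …, I_q^{[k_q]})` read off from a
Hilbert polynomial `P`: `k₀!·j!·k! ·` (coefficient of `n^{k₀} p^j r^k` in `P`). -/
def mixedCoeff {q : ℕ} (P : MvPolynomial (Fin (q + 2)) ℚ) (k0 j : ℕ) (k : Fin q → ℕ) : ℚ :=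
  (k0.factorial * j.factorial * ∏ i, (k i).factorial : ℚ) *
    MvPolynomial.coeff (Finsupp.equivFunOnFinite.symm (Fin.cons k0 (Fin.cons j k))) P

/-- The Hilbert function `ℓ(M_{n+u} / U^n M_u)` of the pair `(U, A)` with respect to `ℳ`. -/
def brLen (U : Submodule R A) (ℳ : ℕ → Submodule R M) (n u : ℕ) : ℕ∞ :=
  colength R (smulSM (U ^ n) (ℳ u)) (ℳ (n + u))

/-- `P` is a polynomial in two variables `(n, u)` agreeing with `ℓ(M_{n+u}/U^n M_u)`
for all large `n, u`. -/
def IsBRPoly (U : Submodule R A) (ℳ : ℕ → Submodule R M)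
    (P : MvPolynomial (Fin 2) ℚ) : Prop :=
  ∃ N₀ : ℕ, ∀ n u : ℕ, N₀ ≤ n → N₀ ≤ u →
    ∃ L : ℕ, brLen U ℳ n u = (L : ℕ∞) ∧
      MvPolynomial.eval ![(n : ℚ), (u : ℚ)] P = (L : ℚ)

/-- The `j`-th associated Buchsbaum-Rim multiplicity read off from a Hilbert polynomial
`P` of total degree `d`: `(d-j)!·j! ·` (coefficient of `n^{d-j} u^j` in `P`). -/
def brCoeff (P : MvPolynomial (Fin 2) ℚ) (d j : ℕ) : ℚ :=
  ((d - j).factorial * j.factorial : ℚ) *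
    MvPolynomial.coeff (Finsupp.equivFunOnFinite.symm ![d - j, j]) P

/-- The graded pieces of the quotient module `M/N`. -/
def quotPieces (ℳ : ℕ → Submodule R M) (N : Submodule A M) : ℕ → Submodule R (M ⧸ N) :=
  fun n => (ℳ n).map (N.mkQ.restrictScalars R)


section Product

variable {R A M : Type*} [CommRing R] [CommRing A] [Algebra R A]
  [AddCommGroup M] [Module R M] [Module A M] [IsScalarTower R A M]

lemma smul_mem_smulSM {I : Submodule R A} {N : Submodule R M} {a : A} {m : M}
    (ha : a ∈ I) (hm : m ∈ N) : a • m ∈ smulSM I N :=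
  Submodule.subset_span ⟨a, ha, m, hm, rfl⟩

lemma smulSM_le {I : Submodule R A} {N P : Submodule R M} :
    smulSM I N ≤ P ↔ ∀ a ∈ I, ∀ m ∈ N, a • m ∈ P := by
  refine ⟨fun h a ha m hm => h (smul_mem_smulSM ha hm), fun h => Submodule.span_le.2 ?_⟩
  rintro _ ⟨a, ha, m, hm, rfl⟩
  exact h a ha m hm

lemma smulSM_mono {I I' : Submodule R A} {N N' : Submodule R M} (hI : I ≤ I') (hN : N ≤ N') :
    smulSM I N ≤ smulSM I' N' :=
  smulSM_le.2 fun _ ha _ hm => smul_mem_smulSM (hI ha) (hN hm)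

lemma smulSM_mul_le (I I' : Submodule R A) (N : Submodule R M) :
    smulSM (I * I') N ≤ smulSM I (smulSM I' N) := by
  refine smulSM_le.2 fun a ha m hm => ?_
  induction ha using Submodule.mul_induction_on' with
  | mem_mul_mem b hb b' hb' =>
    rw [mul_smul]
    exact smul_mem_smulSM hb (smul_mem_smulSM hb' hm)
  | add b _ b' _ h h' =>
    rw [add_smul]
    exact add_mem h h'

lemma smul_smulSM_le_mul {I I' : Submodule R A} {N : Submodule R M} :
    smulSM I (smulSM I' N) ≤ smulSM (I * I') N := by
  refine smulSM_le.2 fun a ha z hz => ?_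
  induction hz using Submodule.span_induction with
  | mem z hz =>
    obtain ⟨b, hb, m, hm, rfl⟩ := hz
    rw [← mul_smul]
    exact smul_mem_smulSM (Submodule.mul_mem_mul ha hb) hm
  | zero => simp
  | add y z _ _ hy hz =>
    rw [smul_add]
    exact add_mem hy hz
  | smul s z _ hz =>
    rw [smul_algebra_smul_comm]
    exact Submodule.smul_mem _ _ hz

lemma smulSM_grading_le {𝒜 : ℕ → Submodule R A} (hgen : ∀ n, 𝒜 n = 𝒜 1 ^ n)
    {ℳ : ℕ → Submodule R M} (hMdeg : ∀ n, ℳ n = smulSM (𝒜 n) (ℳ 0)) (a b : ℕ) :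
    smulSM (𝒜 a) (ℳ b) ≤ ℳ (a + b) := by
  rw [hMdeg b, hMdeg (a + b)]
  refine smul_smulSM_le_mul.trans (smulSM_mono ?_ le_rfl)
  rw [hgen a, hgen b, hgen (a + b), pow_add]

lemma Ipow_le_grading {𝒜 : ℕ → Submodule R A} (hgen : ∀ n, 𝒜 n = 𝒜 1 ^ n)
    {s : ℕ} {F : Fin s → Submodule R A} (hF : ∀ i, F i ≤ 𝒜 1) (r : Fin s → ℕ) :
    Ipow F r ≤ 𝒜 (∑ i, r i) := by
  rw [hgen, ← Finset.prod_pow_eq_pow_sum, Ipow]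
  exact Finset.prod_le_prod' fun i _ => pow_le_pow_left' (hF i) _

lemma mul_Ipow_update {s : ℕ} (F : Fin s → Submodule R A) {r : Fin s → ℕ} {i : Fin s}
    (hr : 0 < r i) : F i * Ipow F (Function.update r i (r i - 1)) = Ipow F r := by
  unfold Ipow
  rw [← Finset.mul_prod_erase _ _ (Finset.mem_univ i),
    ← Finset.mul_prod_erase _ (fun l => F l ^ r l) (Finset.mem_univ i), ← mul_assoc,
    Function.update_self, ← pow_succ', Nat.sub_add_cancel hr]
  congr 1
  refine Finset.prod_congr rfl fun l hl => ?_
  rw [Function.update_of_ne (Finset.ne_of_mem_erase hl)]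

lemma sum_update_pred {s : ℕ} {r : Fin s → ℕ} {i : Fin s} (hr : 0 < r i) :
    ∑ l, Function.update r i (r i - 1) l + 1 = ∑ l, r l := by
  rw [Finset.sum_update_of_mem (Finset.mem_univ i),
    ← Finset.add_sum_erase _ r (Finset.mem_univ i), Finset.sdiff_singleton_eq_erase]
  omega

/-- A sum of submodules of the members of an independent family meets each member
in the corresponding submodule. -/
lemma inf_iSup_le_of_iSupIndep {ℳ N : ℕ → Submodule R M} (hind : iSupIndep ℳ)
    (hN : ∀ e, N e ≤ ℳ e) (d : ℕ) : ℳ d ⊓ ⨆ e, N e ≤ N d := by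
  have hle : ⨆ e, N e ≤ N d ⊔ ⨆ e, ⨆ (_ : e ≠ d), ℳ e := by
    refine iSup_le fun e => ?_
    rcases eq_or_ne e d with rfl | he
    · exact le_sup_left
    · exact (hN e).trans (le_sup_of_le_right (le_iSup₂_of_le e he le_rfl))
  refine (inf_le_inf_left _ hle).trans ?_
  rw [inf_comm, sup_inf_assoc_of_le _ (hN d), inf_comm, (hind d).eq_bot, sup_bot_eq]

/-- The submodule generated by elements of degree one is homogeneous: its part of degree `d + 1`
comes from the part of degree `d` of the module. -/
lemma grading_inf_spanM_le {𝒜 : ℕ → Submodule R A} (hgen : ∀ n, 𝒜 n = 𝒜 1 ^ n)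
    {ℳ : ℕ → Submodule R M} (hMint : DirectSum.IsInternal ℳ)
    (hMdeg : ∀ n, ℳ n = smulSM (𝒜 n) (ℳ 0)) {s : Set A} (hs : s ⊆ 𝒜 1) (d : ℕ) :
    ℳ (d + 1) ⊓ (spanM s : Submodule A M).restrictScalars R ≤
      smulSM (Submodule.span R s) (ℳ d) := by
  let N : ℕ → Submodule R M := fun e => Nat.casesOn e ⊥ fun e => smulSM (Submodule.span R s) (ℳ e)
  have hN : ∀ e, N e ≤ ℳ e
    | 0 => bot_le
    | e + 1 => by
      have h := (smulSM_mono (Submodule.span_le.2 hs) le_rfl).trans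
        (smulSM_grading_le hgen hMdeg 1 e)
      rwa [add_comm 1 e] at h
  have hK : (spanM s : Submodule A M).restrictScalars R ≤ ⨆ e, N e := by
    intro z hz
    rw [Submodule.restrictScalars_mem, spanM] at hz
    induction hz using Submodule.smul_induction_on' with
    | smul a ha m _ =>
      induction ha using Submodule.span_induction generalizing m with
      | mem a ha =>
        have hm : m ∈ ⨆ e, ℳ e := by
          rw [hMint.submodule_iSup_eq_top]
          trivial
        induction hm using Submodule.iSup_induction' with
        | mem e m hm =>
          exact Submodule.mem_iSup_of_mem (p := N) (e + 1)
            (smul_mem_smulSM (Submodule.subset_span ha) hm)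
        | zero => simp
        | add m m' _ _ h h' =>
          rw [smul_add]
          exact add_mem (h trivial) (h' trivial)
      | zero => simp
      | add a b _ _ h h' =>
        rw [add_smul]
        exact add_mem (h m trivial) (h' m trivial)
      | smul b a _ h =>
        rw [smul_eq_mul, mul_comm, mul_smul]
        exact h _ trivial
    | add y _ z _ hy hz => exact add_mem hy hz
  exact (inf_le_inf_left _ hK).trans
    (inf_iSup_le_of_iSupIndep hMint.submodule_iSupIndep hN (d + 1))

end Product

section Sequence

variable {R A M : Type*} [CommRing R] [IsLocalRing R] [CommRing A] [Algebra R A]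
  [AddCommGroup M] [Module R M] [Module A M] [IsScalarTower R A M]

/-- Adjoining a weak-(FC)-element to a set `s` of elements of degree one: an element of `I^r M_p`
in the submodule generated by `s` and `x` is, up to an element of `x I^{r-δ(i)} M_p`, an element
of `I^r M_p` in the submodule generated by `s`. -/
lemma IsWeakFCElemAt.exists_insert_inf_le {𝒜 : ℕ → Submodule R A} (hgen : ∀ n, 𝒜 n = 𝒜 1 ^ n)
    {ℳ : ℕ → Submodule R M} (hMint : DirectSum.IsInternal ℳ)
    (hMdeg : ∀ n, ℳ n = smulSM (𝒜 n) (ℳ 0)) {q : ℕ} {I : Fin q → Submodule R A}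
    (hI1 : ∀ i, I i ≤ 𝒜 1) {𝓘 : Ideal A} {i : Fin q} {x : A} {S : Submodule R A} {s : Set A}
    (hs : s ⊆ 𝒜 1) (hx : IsWeakFCElemAt R ℳ I 𝓘 i x S (spanM s)) :
    ∃ N₀ : ℕ, ∀ (p : ℕ) (r : Fin q → ℕ), N₀ ≤ r i →
      smulSM (Submodule.span R (insert x s)) (ℳ (p + (∑ l, r l) - 1)) ⊓ smulSM (Ipow I r) (ℳ p) ≤
        smulSM (Submodule.span R {x} * Ipow I (Function.update r i (r i - 1))) (ℳ p) ⊔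
          smulSM (Submodule.span R s) (ℳ (p + (∑ l, r l) - 1)) ⊓ smulSM (Ipow I r) (ℳ p) := by
  obtain ⟨hxi, -, ⟨N₀, hpos, hFC⟩, -⟩ := hx
  refine ⟨N₀, fun p r hr z hz => ?_⟩
  have hri : 0 < r i := hpos.trans_le hr
  have hsum := sum_update_pred hri
  have hz' : z ∈ smulSM (Submodule.span R {x}) (ℳ ((∑ l, r l) + p - 1)) ⊔
      (spanM s : Submodule A M).restrictScalars R := by
    refine smulSM_le.2 (fun a ha m hm => ?_) hz.1
    rw [Submodule.span_insert] at ha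
    obtain ⟨b, hb, b', hb', rfl⟩ := Submodule.mem_sup.1 ha
    rw [add_smul]
    refine Submodule.add_mem_sup (smul_mem_smulSM hb (by rwa [add_comm _ p])) ?_
    have hspan : b' ∈ Ideal.span s := Submodule.span_le_restrictScalars R A s hb'
    exact Submodule.smul_mem_smul (I := Ideal.span s) (N := (⊤ : Submodule A M)) hspan trivial
  have hmem := (hFC p r hr).le ⟨Submodule.mem_sup_left hz.2, hz'⟩
  obtain ⟨w, hw, y, hy, rfl⟩ := Submodule.mem_sup.1 hmem
  have hwI : w ∈ smulSM (Ipow I r) (ℳ p) := by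
    refine smulSM_mono ?_ le_rfl hw
    rw [← mul_Ipow_update I hri]
    exact mul_le_mul_left (Submodule.span_le.2 (by simpa using hxi)) _
  have hyI : y ∈ smulSM (Ipow I r) (ℳ p) := by simpa using sub_mem hz.2 hwI
  refine Submodule.add_mem_sup hw ⟨grading_inf_spanM_le hgen hMint hMdeg hs _ ⟨?_, hy⟩, hyI⟩
  have hdeg := ((smulSM_mono (Ipow_le_grading hgen hI1 r) le_rfl).trans
    (smulSM_grading_le hgen hMdeg _ p)) hyI
  rwa [show p + ∑ l, r l - 1 + 1 = ∑ l, r l + p by omega]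

/-- The nontrivial inclusion for the part of an initial segment of a weak-(FC)-sequence
lying in the first `k` blocks. -/
lemma IsWeakFCSeq.exists_span_inf_le {𝒜 : ℕ → Submodule R A} (hgen : ∀ n, 𝒜 n = 𝒜 1 ^ n)
    {ℳ : ℕ → Submodule R M} (hMint : DirectSum.IsInternal ℳ)
    (hMdeg : ∀ n, ℳ n = smulSM (𝒜 n) (ℳ 0)) {q : ℕ} {I : Fin q → Submodule R A}
    (hI1 : ∀ i, I i ≤ 𝒜 1) {𝓘 : Ideal A} {n : ℕ} {x : Fin n → A} {c : Fin n → Fin q}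
    (hmono : Monotone fun j => (c j : ℕ)) (hseq : IsWeakFCSeq R ℳ I 𝓘 x c) (k m : ℕ) :
    ∃ N₀ : ℕ, ∀ (p : ℕ) (r : Fin q → ℕ), (∀ i, N₀ ≤ r i) →
      smulSM (Submodule.span R (x '' {j | (j : ℕ) < m ∧ (c j : ℕ) < k}))
          (ℳ (p + (∑ l, r l) - 1)) ⊓ smulSM (Ipow I r) (ℳ p) ≤
        ⨆ j : Fin n, ⨆ (_ : (c j : ℕ) < k),
          smulSM (Submodule.span R {x j} * Ipow I (Function.update r (c j) (r (c j) - 1))) (ℳ p) := by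
  induction m with
  | zero =>
    refine ⟨0, fun p r _ => inf_le_of_left_le (smulSM_le.2 fun a ha m _ => ?_)⟩
    obtain rfl : a = 0 := by simpa using ha
    simp
  | succ m ih =>
    obtain ⟨N₁, hN₁⟩ := ih
    by_cases hm : ∃ j : Fin n, (j : ℕ) = m ∧ (c j : ℕ) < k
    · obtain ⟨j, rfl, hj⟩ := hm
      have hprev : {l : Fin n | (l : ℕ) < j ∧ (c l : ℕ) < k} = {l | l < j} := by
        ext l
        exact ⟨fun h => h.1, fun h => ⟨h, (hmono (le_of_lt h)).trans_lt hj⟩⟩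
      have hinsert : {l : Fin n | (l : ℕ) < j + 1 ∧ (c l : ℕ) < k} = insert j {l | l < j} := by
        ext l
        simp only [Set.mem_ofPred_eq, Set.mem_insert_iff, Fin.ext_iff, Fin.lt_def]
        refine ⟨fun h => by omega, fun h => ⟨by omega, (hmono ?_).trans_lt hj⟩⟩
        rw [Fin.le_def]
        omega
      have hs : prevSet x j ⊆ 𝒜 1 := by
        rintro _ ⟨l, -, rfl⟩
        exact hI1 _ (hseq l).1
      obtain ⟨N₂, hN₂⟩ := (hseq j).exists_insert_inf_le hgen hMint hMdeg hI1 hs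
      refine ⟨max N₁ N₂, fun p r hr => ?_⟩
      rw [hinsert, Set.image_insert_eq]
      refine (hN₂ p r ((le_max_right _ _).trans (hr _))).trans (sup_le ?_ ?_)
      · exact le_iSup₂_of_le j hj le_rfl
      · have := hN₁ p r fun i => (le_max_left _ _).trans (hr i)
        rwa [hprev] at this
    · have hsame : {l : Fin n | (l : ℕ) < m + 1 ∧ (c l : ℕ) < k} =
          {l : Fin n | (l : ℕ) < m ∧ (c l : ℕ) < k} := by
        ext l
        refine ⟨fun h => ⟨?_, h.2⟩, fun h => ⟨by have := h.1; omega, h.2⟩⟩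
        exact lt_of_le_of_ne (Nat.lt_succ_iff.1 h.1) fun hl => hm ⟨l, hl, h.2⟩
      exact ⟨N₁, by rwa [hsame]⟩

end Sequence

/-! ## Setup (1):
`(R, 𝔪)` a Noetherian local ring; `A` a graded `R`-algebra with grading `𝒜`,
generated as an `R`-algebra by finitely many elements of degree one
(`𝒜 n = (𝒜 1)ⁿ` and `𝒜 1` finitely generated); `M` a finitely generated graded
`A`-module with grading `ℳ`, generated in degree zero (`ℳ n = 𝒜 n · ℳ 0`);
`I₁, …, I_q` finitely generated `R`-submodules of `𝒜 1`; `𝓘 = idealGen I` the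
ideal of `A` generated by `I₁⋯I_q`. -/

variable {R A M : Type*} [CommRing R] [IsNoetherianRing R] [IsLocalRing R]
  [CommRing A] [Algebra R A]
  [AddCommGroup M] [Module R M] [Module A M] [IsScalarTower R A M]

/-- Let `x₁₁, …, x₁ₘ ∈ I₁`, `x₂₁, …, x₂ₙ ∈ I₂`, …, `x_{t1}, …, x_{tp₀} ∈ I_t` be a maximal
weak-(FC)-sequence with respect to `(I₁, …, I_q; M)` contained in `I₁ ∪ ⋯ ∪ I_q` (encoded by
a sequence `x` together with a monotone block-assignment `c` with blocks exactly `0, …, t-1`),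
and let `𝔍_j` be the `R`-submodule generated by the elements of the `j`-th block. Then for any
`k ≤ t`: `(𝔍₁ + ⋯ + 𝔍_k) M_{p+|r|-1} ∩ I^r M_p = Σ_{j=1}^k 𝔍_j I^{r-δ(j)} M_p` for all
sufficiently large `r₁, …, r_q` and all `p`. -/
theorem maximal_weakFC_intersection
    (𝒜 : ℕ → Submodule R A) [GradedAlgebra 𝒜]
    (hgen : ∀ n, 𝒜 n = 𝒜 1 ^ n) (hGfg : (𝒜 1).FG)
    (ℳ : ℕ → Submodule R M) (hMint : DirectSum.IsInternal ℳ)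
    (hMdeg : ∀ n, ℳ n = smulSM (𝒜 n) (ℳ 0)) [Module.Finite A M]
    {q : ℕ} (I : Fin q → Submodule R A) (hI1 : ∀ i, I i ≤ 𝒜 1) (hIfg : ∀ i, (I i).FG)
    (J : Submodule R A) (hJ1 : J ≤ 𝒜 1) (hJfg : J.FG) (hJco : colength R J (𝒜 1) ≠ ⊤)
    (h𝓘 : ¬ idealGen I ≤ (Module.annihilator A M).radical)
    {n : ℕ} (x : Fin n → A) (c : Fin n → Fin q)
    (hmono : Monotone fun j => ((c j : ℕ)))
    (t : ℕ) (hblocks : ∀ i : Fin q, (∃ j, c j = i) ↔ (i : ℕ) < t)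
    (hseq : IsWeakFCSeq R ℳ I (idealGen I) x c)
    (hmax : ¬ ∃ (y : A) (i : Fin q), IsWeakFCElemAt R ℳ I (idealGen I) i y
      (Submodule.span R (Set.range x)) (spanM (Set.range x)))
    (k : ℕ) (hk : k ≤ t) :
    ∃ N₀ : ℕ, ∀ (p : ℕ) (r : Fin q → ℕ), (∀ i, N₀ ≤ r i) →
      smulSM (⨆ i : Fin q, ⨆ (_ : (i : ℕ) < k), Submodule.span R (x '' {j | c j = i}))
          (ℳ (p + (∑ l, r l) - 1)) ⊓ smulSM (Ipow I r) (ℳ p) =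
        ⨆ i : Fin q, ⨆ (_ : (i : ℕ) < k),
          smulSM (Submodule.span R (x '' {j | c j = i}) *
            Ipow I (Function.update r i (r i - 1))) (ℳ p) := by
  obtain ⟨N₀, hN₀⟩ := hseq.exists_span_inf_le hgen hMint hMdeg hI1 hmono k n
  refine ⟨max N₀ 1, fun p r hr => le_antisymm ?_ ?_⟩
  · refine (inf_le_inf_right _ (smulSM_mono (iSup₂_le fun i hi => ?_) le_rfl)).trans
      ((hN₀ p r fun i => (le_max_left _ _).trans (hr i)).trans (iSup₂_le fun j hj => ?_))
    · refine Submodule.span_mono (Set.image_mono ?_)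
      rintro j rfl
      exact ⟨j.2, hi⟩
    · refine le_iSup₂_of_le (c j) hj (smulSM_mono (mul_le_mul_left ?_ _) le_rfl)
      exact Submodule.span_mono (Set.singleton_subset_iff.2 ⟨j, rfl, rfl⟩)
  · refine iSup₂_le fun i hi => ?_
    have hri : 0 < r i := (le_max_right N₀ 1).trans (hr i)
    have hsum := sum_update_pred hri
    refine le_inf ?_ (smulSM_mono ?_ le_rfl)
    · refine (smulSM_mul_le _ _ _).trans
        (smulSM_mono (le_iSup₂_of_le i hi le_rfl) ?_)
      rw [show p + ∑ l, r l - 1 = ∑ l, Function.update r i (r i - 1) l + p by omega]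
      exact (smulSM_mono (Ipow_le_grading hgen hI1 _) le_rfl).trans
        (smulSM_grading_le hgen hMdeg _ p)
    · rw [← mul_Ipow_update I hri]
      refine mul_le_mul_left (Submodule.span_le.2 ?_) _
      rintro _ ⟨j, rfl, rfl⟩
      exact (hseq j).1

end MixedMult
end
end

section
/- Assume 𝓘 is not contained in the radical of Ann(M). Then for all sufficiently large n, p and r one has ℓ(I^r M_{n+p}/J^n I^r M_p) = ℓ(I^r M*_{n+p}/J^n I^r M*_p); consequently e^j(J^{[k_0]}, I_1^{[k_1]},…,I_q^{[k_q]}; M) = e^j(J^{[k_0]}, I_1^{[k_1]},…,I_q^{[k_q]}; M*) for all non-negative integers k_0, j, k_1,…,k_q with k_0 + j + |k| = D. -/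
/- Common framework: graded algebras over a Noetherian local ring, products of
linear submodules with graded pieces of a module, (FC)-sequences, saturations,
Hilbert polynomials of several variables, mixed multiplicities and
Buchsbaum-Rim multiplicities. -/

open scoped BigOperators

noncomputable section

namespace MixedMult

variable {R A M : Type*} [CommRing R] [CommRing A] [Algebra R A]
  [AddCommGroup M] [Module R M] [Module A M] [IsScalarTower R A M]

theorem smulSM_le_s6 {S B V : Type*} [CommRing S] [CommRing B] [Algebra S B] [AddCommGroup V]
    [Module S V] [Module B V] {I : Submodule S B} {N L : Submodule S V} :
    smulSM I N ≤ L ↔ ∀ a ∈ I, ∀ m ∈ N, a • m ∈ L := by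
  refine Submodule.span_le.trans ⟨fun h a ha m hm => h ⟨a, ha, m, hm, rfl⟩, ?_⟩
  rintro h _ ⟨a, ha, m, hm, rfl⟩
  exact h a ha m hm


theorem smulSM_map_mkQ (I : Submodule R A) (N : Submodule R M) (K : Submodule A M) :
    smulSM I (N.map (K.mkQ.restrictScalars R)) =
      (smulSM I N).map (K.mkQ.restrictScalars R) := by
  rw [smulSM, smulSM, Submodule.map_span]
  congr 1
  ext z
  constructor
  · rintro ⟨a, ha, _, ⟨m, hm, rfl⟩, rfl⟩
    exact ⟨a • m, ⟨a, ha, m, hm, rfl⟩, map_smul K.mkQ a m⟩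
  · rintro ⟨_, ⟨a, ha, m, hm, rfl⟩, rfl⟩
    exact ⟨a, ha, _, ⟨m, hm, rfl⟩, (map_smul K.mkQ a m).symm⟩

/-- Colengths are invariant under a linear map which is injective on a submodule containing
both of the submodules involved. -/
theorem colength_map_of_disjoint_ker {S V W : Type*} [CommRing S] [AddCommGroup V]
    [AddCommGroup W] [Module S V] [Module S W] (f : V →ₗ[S] W) {L P Q : Submodule S V}
    (hP : P ≤ L) (hQ : Q ≤ L) (hL : Disjoint L (LinearMap.ker f)) :
    colength S (P.map f) (Q.map f) = colength S P Q := by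
  have hinj : ∀ x ∈ L, ∀ y ∈ L, f x = f y → x = y := LinearMap.injOn_of_disjoint_ker le_rfl hL
  let g : Q →ₗ[S] Q.map f := f.submoduleMap Q
  have hg : Function.Bijective g := by
    refine ⟨fun x y hxy => ?_, f.submoduleMap_surjective Q⟩
    exact Subtype.ext (hinj x (hQ x.2) y (hQ y.2) (congrArg Subtype.val hxy))
  let e : Q ≃ₗ[S] Q.map f := LinearEquiv.ofBijective g hg
  have he : (P.comap Q.subtype).map (e : Q →ₗ[S] Q.map f) =
      (P.map f).comap (Q.map f).subtype := by
    ext z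
    constructor
    · rintro ⟨x, hx, rfl⟩
      exact ⟨x, hx, rfl⟩
    · rintro ⟨w, hw, hwz⟩
      obtain ⟨x, rfl⟩ := hg.2 z
      have hwx : w = x := hinj w (hP hw) x (hQ x.2) hwz
      exact ⟨x, show (x : V) ∈ P from hwx ▸ hw, rfl⟩
  have h := Order.height_orderIso
    (Submodule.orderIsoMapComap (Submodule.Quotient.equiv _ _ e he)) ⊤
  rw [map_top] at h
  exact h

/-- A power of `𝓘` annihilates the `𝓘`-torsion of a Noetherian module. -/
theorem exists_pow_smul_sat_bot_eq_bot {B N : Type*} [CommRing B] [AddCommGroup N] [Module B N]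
    [IsNoetherian B N] (𝓘 : Ideal B) :
    ∃ k : ℕ, 𝓘 ^ k • sat 𝓘 (⊥ : Submodule B N) = ⊥ := by
  let f : ℕ →o Submodule B N :=
    { toFun := fun k => ⨅ a ∈ 𝓘 ^ k, (⊥ : Submodule B N).comap (LinearMap.lsmul B N a)
      monotone' := fun _ _ hkl => biInf_mono fun _ ha => Ideal.pow_le_pow_right hkl ha }
  obtain ⟨k, hk⟩ := monotone_stabilizes_iff_noetherian.mpr ‹IsNoetherian B N› f
  have hsat : sat 𝓘 (⊥ : Submodule B N) ≤ f k := iSup_le fun l => by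
    rcases le_total k l with h | h
    · exact (hk l h).ge
    · exact f.monotone h
  refine ⟨k, le_bot_iff.mp (Submodule.smul_le.mpr fun a ha z hz => ?_)⟩
  have hz' := (Submodule.mem_iInf _).mp (hsat hz) a
  exact (Submodule.mem_iInf _).mp hz' ha

/-- By Artin–Rees, high powers of `𝓘` meet the `𝓘`-torsion trivially. -/
theorem exists_disjoint_pow_smul_top_sat_bot {B N : Type*} [CommRing B] [IsNoetherianRing B]
    [AddCommGroup N] [Module B N] [Module.Finite B N] (𝓘 : Ideal B) :
    ∃ k : ℕ, Disjoint (𝓘 ^ k • (⊤ : Submodule B N)) (sat 𝓘 ⊥) := by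
  obtain ⟨k, hk⟩ := exists_pow_smul_sat_bot_eq_bot (N := N) 𝓘
  obtain ⟨c, hc⟩ := Ideal.exists_pow_inf_eq_pow_smul 𝓘 (sat 𝓘 (⊥ : Submodule B N))
  refine ⟨k + c, disjoint_iff.mpr (le_bot_iff.mp ?_)⟩
  rw [hc (k + c) (Nat.le_add_left c k), Nat.add_sub_cancel]
  exact (Submodule.smul_mono le_rfl inf_le_right).trans hk.le

theorem Ipow_le_idealGen_pow {s : ℕ} (I : Fin s → Submodule R A) {k : ℕ} {r : Fin s → ℕ}
    (hr : ∀ i, k ≤ r i) : Ipow I r ≤ (idealGen I ^ k : Ideal A).restrictScalars R := by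
  have hfac : Ipow I r = (∏ i, I i) ^ k * Ipow I (fun i => r i - k) := by
    simp only [Ipow, ← Finset.prod_pow, ← Finset.prod_mul_distrib, ← pow_add]
    exact Finset.prod_congr rfl fun i _ => by rw [Nat.add_sub_cancel' (hr i)]
  have hpow : ∀ l : ℕ, ((∏ i, I i) ^ l : Submodule R A) ≤
      (idealGen I ^ l : Ideal A).restrictScalars R := by
    intro l
    induction l with
    | zero => intro x _; simp
    | succ l ih =>
      rw [pow_succ, pow_succ]
      exact Submodule.mul_le.mpr fun a ha b hb =>
        Ideal.mul_mem_mul (ih ha) (Ideal.subset_span hb)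
  rw [hfac]
  exact Submodule.mul_le.mpr fun a ha b _ => Ideal.mul_mem_right b _ (hpow k ha)

/-- A graded algebra over a Noetherian ring generated by finitely many elements of degree one
is Noetherian. -/
theorem isNoetherianRing_of_fg_degree_one [IsNoetherianRing R] (𝒜 : ℕ → Submodule R A)
    [GradedAlgebra 𝒜] (hgen : ∀ n, 𝒜 n = 𝒜 1 ^ n) (hfg : (𝒜 1).FG) : IsNoetherianRing A := by
  obtain ⟨s, hs⟩ := hfg
  have h1 : 𝒜 1 ≤ Subalgebra.toSubmodule (Algebra.adjoin R (s : Set A)) :=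
    hs ▸ Submodule.span_le.mpr Algebra.subset_adjoin
  have hle : ∀ n, 𝒜 n ≤ Subalgebra.toSubmodule (Algebra.adjoin R (s : Set A)) := fun n => by
    rw [hgen n]
    induction n with
    | zero => exact Submodule.one_le.mpr (one_mem (Algebra.adjoin R (s : Set A)))
    | succ n ih =>
      rw [pow_succ]
      exact Submodule.mul_le.mpr fun a ha b hb => Subalgebra.mul_mem _ (ih ha) (h1 hb)
  classical
  have htop : Algebra.adjoin R (s : Set A) = ⊤ := by
    rw [eq_top_iff]
    intro x _
    rw [← DirectSum.sum_support_decompose 𝒜 x]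
    exact sum_mem fun n _ => hle n (DirectSum.decompose 𝒜 x n).2
  have : Algebra.FiniteType R A := ⟨⟨s, htop⟩⟩
  exact Algebra.FiniteType.isNoetherianRing R A

/-- Two polynomials which agree at all points with large natural coordinates are equal. -/
theorem eq_of_eval_vals_eq {q N₀ : ℕ} {P P' : MvPolynomial (Fin (q + 2)) ℚ}
    (h : ∀ (n p : ℕ) (r : Fin q → ℕ), N₀ ≤ n → N₀ ≤ p → (∀ i, N₀ ≤ r i) →
      MvPolynomial.eval (vals n p r) P = MvPolynomial.eval (vals n p r) P') : P = P' := by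
  refine MvPolynomial.funext_set (fun _ => (Nat.cast : ℕ → ℚ) '' Set.Ici N₀)
    (fun _ => (Set.Ici_infinite N₀).image Nat.cast_injective.injOn) fun x hx => ?_
  choose y hy hyx using fun i => hx i (Set.mem_univ i)
  have hvals : x = vals (y 0) (y 1) fun i => y i.succ.succ := by
    rw [← funext hyx]
    ext i
    refine Fin.cases rfl (fun i => Fin.cases rfl (fun i => rfl) i) i
  rw [hvals]
  exact h _ _ _ (hy 0) (hy 1) fun i => hy i.succ.succ

/-- If `𝓘^k M` meets `K` trivially, then passing to `M/K` does not change the Hilbert function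
in the range `r ≥ k`. -/
theorem mixedLen_quotPieces {q k : ℕ} (J : Submodule R A) (I : Fin q → Submodule R A)
    (ℳ : ℕ → Submodule R M) {K : Submodule A M}
    (hK : Disjoint (idealGen I ^ k • (⊤ : Submodule A M)) K) (n p : ℕ) {r : Fin q → ℕ}
    (hr : ∀ i, k ≤ r i) :
    mixedLen J I (quotPieces ℳ K) n p r = mixedLen J I ℳ n p r := by
  have hI := Ipow_le_idealGen_pow I hr
  simp only [mixedLen, quotPieces, smulSM_map_mkQ]
  have hL {F : Submodule R A} (hF : F ≤ (idealGen I ^ k : Ideal A).restrictScalars R)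
      (N : Submodule R M) :
      smulSM F N ≤ (idealGen I ^ k • (⊤ : Submodule A M)).restrictScalars R :=
    smulSM_le_s6.mpr fun a ha m _ =>
      Submodule.smul_mem_smul (I := idealGen I ^ k) (hF ha) Submodule.mem_top
  refine colength_map_of_disjoint_ker _ (hL ?_ _) (hL hI _) ?_
  · exact Submodule.mul_le.mpr fun b _ c hc => Ideal.mul_mem_left _ b (hI hc)
  · rw [Submodule.disjoint_def] at hK ⊢
    intro x hx hxK
    exact hK x hx ((Submodule.Quotient.mk_eq_zero K).mp hxK)

/-! ## Setup (1):
`(R, 𝔪)` a Noetherian local ring; `A` a graded `R`-algebra with grading `𝒜`,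
generated as an `R`-algebra by finitely many elements of degree one
(`𝒜 n = (𝒜 1)ⁿ` and `𝒜 1` finitely generated); `M` a finitely generated graded
`A`-module with grading `ℳ`, generated in degree zero (`ℳ n = 𝒜 n · ℳ 0`);
`I₁, …, I_q` finitely generated `R`-submodules of `𝒜 1`; `𝓘 = idealGen I` the
ideal of `A` generated by `I₁⋯I_q`. -/

variable {R A M : Type*} [CommRing R] [IsNoetherianRing R] [IsLocalRing R]
  [CommRing A] [Algebra R A]
  [AddCommGroup M] [Module R M] [Module A M] [IsScalarTower R A M]

/-- Assume `𝓘` is not contained in `√(Ann M)`. Then for all sufficiently large `n, p, r` one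
has `ℓ(I^r M_{n+p}/Jⁿ I^r M_p) = ℓ(I^r M*_{n+p}/Jⁿ I^r M*_p)`, where `M* = M/(0 : 𝓘^∞)`;
consequently the mixed multiplicities of `(J, I₁, …, I_q)` with respect to `M` and with
respect to `M*` coincide. -/
theorem mixedLen_eq_saturation_and_mixed_multiplicities_eq
    (𝒜 : ℕ → Submodule R A) [GradedAlgebra 𝒜]
    (hgen : ∀ n, 𝒜 n = 𝒜 1 ^ n) (hGfg : (𝒜 1).FG)
    (ℳ : ℕ → Submodule R M) (hMint : DirectSum.IsInternal ℳ)
    (hMdeg : ∀ n, ℳ n = smulSM (𝒜 n) (ℳ 0)) [Module.Finite A M]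
    {q : ℕ} (I : Fin q → Submodule R A) (hI1 : ∀ i, I i ≤ 𝒜 1) (hIfg : ∀ i, (I i).FG)
    (J : Submodule R A) (hJ1 : J ≤ 𝒜 1) (hJfg : J.FG) (hJco : colength R J (𝒜 1) ≠ ⊤)
    (h𝓘 : ¬ idealGen I ≤ (Module.annihilator A M).radical)
    (D : ℕ)
    (hD : dimProjSupp 𝒜 (sat (idealGen I) (⊥ : Submodule A M)) = ((D : ℕ∞) : WithBot ℕ∞)) :
    (∃ N₀ : ℕ, ∀ (n p : ℕ) (r : Fin q → ℕ), N₀ ≤ n → N₀ ≤ p → (∀ i, N₀ ≤ r i) →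
      mixedLen J I ℳ n p r =
        mixedLen J I (quotPieces ℳ (sat (idealGen I) (⊥ : Submodule A M))) n p r) ∧
    (∀ (k0 j : ℕ) (k : Fin q → ℕ), k0 + j + ∑ i, k i = D →
      ∀ (P P' : MvPolynomial (Fin (q + 2)) ℚ), IsMixedPoly J I ℳ P →
        IsMixedPoly J I (quotPieces ℳ (sat (idealGen I) (⊥ : Submodule A M))) P' →
        mixedCoeff P k0 j k = mixedCoeff P' k0 j k) := by
  have := isNoetherianRing_of_fg_degree_one 𝒜 hgen hGfg
  obtain ⟨k, hk⟩ := exists_disjoint_pow_smul_top_sat_bot (N := M) (idealGen I)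
  have hlen := fun n p (r : Fin q → ℕ) (hr : ∀ i, k ≤ r i) =>
    mixedLen_quotPieces J I ℳ hk n p hr
  refine ⟨⟨k, fun n p r _ _ hr => (hlen n p r hr).symm⟩, ?_⟩
  rintro k0 j e - P P' ⟨N, hN⟩ ⟨N', hN'⟩
  suffices P = P' by rw [this]
  refine eq_of_eval_vals_eq (N₀ := max k (max N N')) fun n p r hn hp hr => ?_
  simp only [max_le_iff] at hn hp hr
  obtain ⟨L, hL, hPL⟩ := hN n p r hn.2.1 hp.2.1 fun i => (hr i).2.1
  obtain ⟨L', hL', hPL'⟩ := hN' n p r hn.2.2 hp.2.2 fun i => (hr i).2.2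
  rw [hlen n p r fun i => (hr i).1, hL, Nat.cast_inj] at hL'
  rw [hPL, hPL', hL']

end MixedMult
end
end
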